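/- Let A be a finite set of atoms and S ⊆ S_A a set of SE-interpretations over A that is complete and closed under here-union. Then there exists a dual-normal program P with at(P) ⊆ A such that {(X,Y) ∈ S_A : (X,Y) is an SE-model of P} = S. -/

import Mathlib

open Classical

noncomputable section

/-- A rule of a disjunctive logic program: head, positive body, negative body. -/
structure Rule (A : Type*) where
  head : Finset A
  bodyP : Finset A
  bodyN : Finset A
  deriving DecidableEq

/-- A program is a finite set of rules. -/
abbrev Program (A : Type*) := Finset (Rule A)

variable {A : Type*} [DecidableEq A]

/-- The atoms occurring in a program. -/
def atoms (P : Program A) : Finset A := P.sup (fun r => r.head ∪ r.bodyP ∪ r.bodyN)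

/-- An interpretation `I` satisfies a rule `r` iff `(H(r) ∪ B⁻(r)) ∩ I ≠ ∅` or `B⁺(r) \ I ≠ ∅`. -/
def satR (I : Set A) (r : Rule A) : Prop :=
  (∃ a ∈ r.head ∪ r.bodyN, a ∈ I) ∨ (∃ a ∈ r.bodyP, a ∉ I)

/-- `I` is a model of `P` iff it satisfies every rule of `P`. -/
def isModel (I : Set A) (P : Program A) : Prop := ∀ r ∈ P, satR I r

/-- The Gelfond-Lifschitz reduct `P^I`. -/
def reduct (P : Program A) (I : Set A) : Program A :=
  (P.filter (fun r => ∀ a ∈ r.bodyN, a ∉ I)).image (fun r => ⟨r.head, r.bodyP, ∅⟩)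

/-- `I` is an inclusion-minimal model of `P`. -/
def isMinModel (I : Set A) (P : Program A) : Prop :=
  isModel I P ∧ ∀ J ⊆ I, isModel J P → J = I

/-- `I` is an answer set of `P` iff `I` is a minimal model of the reduct `P^I`. -/
def isAnswerSet (I : Set A) (P : Program A) : Prop := isMinModel I (reduct P I)

/-- The collection of answer sets of `P`. -/
def AS (P : Program A) : Set (Set A) := {M | isAnswerSet M P}

/-- Dual-Horn: every rule has at most one positive body atom and empty negative body. -/
def dualHorn (P : Program A) : Prop := ∀ r ∈ P, r.bodyP.card ≤ 1 ∧ r.bodyN = ∅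

/-- Dual-normal: every rule is a constraint or has at most one positive body atom. -/
def dualNormal (P : Program A) : Prop := ∀ r ∈ P, r.head = ∅ ∨ r.bodyP.card ≤ 1

/-- Normal: every rule has at most one head atom. -/
def normal (P : Program A) : Prop := ∀ r ∈ P, r.head.card ≤ 1

/-- The proper rules (non-constraints) of `P`. -/
def properPart (P : Program A) : Program A := P.filter (fun r => r.head ≠ ∅)

/-- The constraints of `P`. -/
def constraintPart (P : Program A) : Program A := P.filter (fun r => r.head = ∅)

/-- `P[t]`: replace each rule with empty positive body by one whose positive body is `{t}`. -/
def progT (P : Program A) (t : A) : Program A :=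
  P.image (fun r => if r.bodyP = ∅ then ⟨r.head, {t}, r.bodyN⟩ else r)

/-- The elimination sets `E_i` computed from `P[t]` (for `P` dual-Horn). -/
def E (P : Program A) (t : A) : ℕ → Set A
  | 0 => ∅
  | (i+1) => {b | ∃ r ∈ progT P t, r.bodyP = {b} ∧ ↑r.head ⊆ E P t i}

/-- The program `P_{M,m}`. -/
def pmm (P : Program A) (M : Set A) (m : A) : Program A :=
  reduct (properPart P) M ∪
    ((atoms P).filter (fun b => b ∉ M)).image (fun b => ⟨∅, {b}, ∅⟩) ∪
    {⟨∅, {m}, ∅⟩}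

/-- `(X, Y)` is an SE-model of `P` iff `Y ⊨ P` and `X ⊨ P^Y`
(SE-interpretations additionally require `X ⊆ Y`). -/
def isSEModel (P : Program A) (X Y : Set A) : Prop :=
  isModel Y P ∧ isModel X (reduct P Y)

/-- The set of all SE-models of `P` (as SE-interpretations, i.e. with `X ⊆ Y`). -/
def SEset (P : Program A) : Set (Set A × Set A) :=
  {p | p.1 ⊆ p.2 ∧ isSEModel P p.1 p.2}

/-- `(X, Y)` is a UE-model of `P`: an SE-model such that every SE-model `(X', Y)` with
`X ⊊ X'` satisfies `X' = Y`. -/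
def isUEModel (P : Program A) (X Y : Set A) : Prop :=
  isSEModel P X Y ∧ ∀ X' : Set A, X' ⊆ Y → isSEModel P X' Y → X ⊂ X' → X' = Y

/-- The set of all UE-models of `P` (as SE-interpretations, i.e. with `X ⊆ Y`). -/
def UEset (P : Program A) : Set (Set A × Set A) :=
  {p | p.1 ⊆ p.2 ∧ isUEModel P p.1 p.2}

/-- A set of SE-interpretations is complete. -/
def completeSE {B : Type*} (S : Set (Set B × Set B)) : Prop :=
  (∀ X Y : Set B, (X, Y) ∈ S → (Y, Y) ∈ S) ∧
  (∀ X Y Z : Set B, (X, Y) ∈ S → (Z, Z) ∈ S → Y ⊆ Z → (X, Z) ∈ S)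

/-- A set of SE-interpretations is closed under here-union. -/
def closedHereUnion {B : Type*} (S : Set (Set B × Set B)) : Prop :=
  ∀ X X' Y : Set B, (X, Y) ∈ S → (X', Y) ∈ S → (X ∪ X', Y) ∈ S

/-- A set of SE-interpretations is UE-complete. -/
def UEComplete {B : Type*} (S : Set (Set B × Set B)) : Prop :=
  (∀ X Y : Set B, (X, Y) ∈ S → (Y, Y) ∈ S) ∧
  (∀ X Y Z : Set B, (X, Y) ∈ S → (Z, Z) ∈ S → Y ⊂ Z →
    ∃ Y' : Set B, Y ⊆ Y' ∧ Y' ⊂ Z ∧ (Y', Z) ∈ S) ∧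
  (∀ X X' Y : Set B, (X, Y) ∈ S → (X', Y) ∈ S → X ⊂ X' → X' = Y)

/-- A set of SE-interpretations is splittable: for every `(Z,Z) ∈ S` and every finite
nonempty family `(X₁,Y₁), …, (X_k,Y_k) ∈ S` with all `Yᵢ ⊆ Z`, either
`(X₁ ∪ ⋯ ∪ X_k, Z) ∈ S` or `(Z', Z) ∈ S` for some `Z'` with
`X₁ ∪ ⋯ ∪ X_k ⊆ Z' ⊊ Z`. -/
def splittable {B : Type*} (S : Set (Set B × Set B)) : Prop :=
  ∀ Z : Set B, (Z, Z) ∈ S →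
    ∀ (n : ℕ) (p : Fin (n + 1) → Set B × Set B),
      (∀ i, p i ∈ S) → (∀ i, (p i).2 ⊆ Z) →
      ((⋃ i, (p i).1), Z) ∈ S ∨
        ∃ Z' : Set B, (⋃ i, (p i).1) ⊆ Z' ∧ Z' ⊂ Z ∧ (Z', Z) ∈ S

theorem isModel_reduct_iff (P : Program A) (X Y : Set A) :
    isModel X (reduct P Y) ↔ ∀ r ∈ P, (∀ a ∈ r.bodyN, a ∉ Y) →
      ((∃ a ∈ r.head, a ∈ X) ∨ ∃ a ∈ r.bodyP, a ∉ X) := by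
  unfold isModel reduct satR
  constructor
  · intro h r hr hn
    have := h ⟨r.head, r.bodyP, ∅⟩
      (Finset.mem_image.2 ⟨r, Finset.mem_filter.2 ⟨hr, hn⟩, rfl⟩)
    simpa using this
  · intro h r' hr'
    obtain ⟨r, hr, rfl⟩ := Finset.mem_image.1 hr'
    obtain ⟨hr, hn⟩ := Finset.mem_filter.1 hr
    simpa using h r hr hn

/-- A rule that holds in all SE-interpretations of `S`. -/
def validIn (S : Set (Set A × Set A)) (r : Rule A) : Prop :=
  ∀ p ∈ S, satR p.2 r ∧ ((∀ a ∈ r.bodyN, a ∉ p.2) →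
      ((∃ a ∈ r.head, a ∈ p.1) ∨ ∃ a ∈ r.bodyP, a ∉ p.1))

/-- All dual-normal rules over a finite set which are valid in `S`. -/
def canonProg (F : Finset A) (S : Set (Set A × Set A)) : Program A :=
  ((F.powerset ×ˢ F.powerset ×ˢ F.powerset).image
    (fun t => (⟨t.1, t.2.1, t.2.2⟩ : Rule A))).filter
    (fun r => (r.head = ∅ ∨ r.bodyP.card ≤ 1) ∧ validIn S r)

theorem mem_canonProg (F : Finset A) (S : Set (Set A × Set A)) (r : Rule A) :
    r ∈ canonProg F S ↔ (r.head ⊆ F ∧ r.bodyP ⊆ F ∧ r.bodyN ⊆ F) ∧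
      (r.head = ∅ ∨ r.bodyP.card ≤ 1) ∧ validIn S r := by
  unfold canonProg
  rw [Finset.mem_filter, Finset.mem_image]
  refine and_congr_left fun _ => ?_
  constructor
  · rintro ⟨t, ht, rfl⟩
    simpa using ht
  · intro h
    exact ⟨(r.head, r.bodyP, r.bodyN), by simpa using h, rfl⟩

/-- With here-union, a pair outside `S` is separated using at most one atom. -/
theorem exists_body (F : Finset A) (S : Set (Set A × Set A)) (hu : closedHereUnion S)
    (X Y : Set A) (hX : X ⊆ ↑F) (h : (X, Y) ∉ S) :
    ∃ B : Finset A, B.card ≤ 1 ∧ ↑B ⊆ X ∧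
      ∀ X' ⊆ X, (X', Y) ∈ S → ∃ a ∈ B, a ∉ X' := by
  by_contra hcon
  push Not at hcon
  have hfin : {X' : Set A | X' ⊆ X ∧ (X', Y) ∈ S}.Finite :=
    ((F.finite_toSet.subset hX).finite_subsets).subset fun _ h => h.1
  obtain ⟨X0, h0, h0S, -⟩ := hcon ∅ (by simp) (by simp)
  obtain ⟨M, hM⟩ := hfin.exists_maximal ⟨X0, h0, h0S⟩
  have : M = X := by
    refine Set.Subset.antisymm hM.1.1 fun a ha => ?_
    obtain ⟨X', h1, h2, h3⟩ := hcon {a} (by simp) (by simpa using ha)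
    have h4 : M ∪ X' ⊆ M :=
      hM.2 ⟨Set.union_subset hM.1.1 h1, hu _ _ _ hM.1.2 h2⟩ Set.subset_union_left
    exact h4 (Or.inr (h3 a (by simp)))
  exact h (this ▸ hM.1.2)

/-- For every finite set `A` of atoms and every set `S ⊆ S_A` of
SE-interpretations over `A` that is complete and closed under here-union, there is a
dual-normal program `P` with `at(P) ⊆ A` whose SE-models over `S_A` are exactly `S`. -/
theorem complete_closedHereUnion_realized_by_dualNormal
    (Afin : Finset A) (S : Set (Set A × Set A))
    (hS : ∀ p ∈ S, p.1 ⊆ p.2 ∧ p.2 ⊆ ↑Afin)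
    (hc : completeSE S) (hu : closedHereUnion S) :
    ∃ P : Program A, ↑(atoms P) ⊆ (↑Afin : Set A) ∧ dualNormal P ∧
      {p : Set A × Set A | p.1 ⊆ p.2 ∧ p.2 ⊆ ↑Afin ∧ isSEModel P p.1 p.2} = S := by
  refine ⟨canonProg Afin S, ?_, ?_, ?_⟩
  · rw [Finset.coe_subset]
    unfold atoms
    refine Finset.sup_le fun r hr => ?_
    obtain ⟨⟨h1, h2, h3⟩, -⟩ := (mem_canonProg _ _ _).1 hr
    exact Finset.union_subset (Finset.union_subset h1 h2) h3
  · intro r hr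
    exact ((mem_canonProg _ _ _).1 hr).2.1
  · ext ⟨X, Y⟩
    constructor
    · rintro ⟨hXY, hY, hm, hr⟩
      simp only at hXY hY hm hr
      rw [isModel_reduct_iff] at hr
      by_contra hn
      by_cases hYY : (Y, Y) ∈ S
      · obtain ⟨B, hB1, hBX, hB⟩ := exists_body Afin S hu X Y (hXY.trans hY) hn
        have key : ∀ X' Z, (X', Z) ∈ S → Z ⊆ Y →
            (∃ a ∈ Afin.filter (fun a => a ∈ Y ∧ a ∉ X), a ∈ X') ∨ ∃ a ∈ B, a ∉ X' := by
          intro X' Z hZ hZY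
          by_cases hsub : X' ⊆ X
          · exact Or.inr (hB X' hsub (hc.2 _ _ _ hZ hYY hZY))
          · obtain ⟨a, ha, ha'⟩ := Set.not_subset.1 hsub
            have := hZY ((hS _ hZ).1 ha)
            exact Or.inl ⟨a, Finset.mem_filter.2 ⟨hY this, this, ha'⟩, ha⟩
        have hsub : ∀ Z ⊆ (↑Afin : Set A),
            (∀ a ∈ Afin.filter (fun a => a ∉ Y), a ∉ Z) → Z ⊆ Y := by
          intro Z hZ h a ha
          by_contra hc
          exact h a (Finset.mem_filter.2 ⟨hZ ha, hc⟩) ha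
        have hmem : (⟨Afin.filter (fun a => a ∈ Y ∧ a ∉ X), B,
            Afin.filter (fun a => a ∉ Y)⟩ : Rule A) ∈ canonProg Afin S := by
          rw [mem_canonProg]
          refine ⟨⟨Finset.filter_subset _ _, fun a ha => hY (hXY (hBX ha)),
            Finset.filter_subset _ _⟩, Or.inr hB1, ?_⟩
          rintro ⟨X', Z⟩ hp
          refine ⟨?_, fun h => key X' Z hp (hsub Z (hS _ hp).2 h)⟩
          by_cases h : ∀ a ∈ Afin.filter (fun a => a ∉ Y), a ∉ Z
          · rcases key Z Z (hc.1 _ _ hp) (hsub Z (hS _ hp).2 h) with ⟨a, h1, h2⟩ | h'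
            · exact Or.inl ⟨a, Finset.mem_union_left _ h1, h2⟩
            · exact Or.inr h'
          · push Not at h
            obtain ⟨a, h1, h2⟩ := h
            exact Or.inl ⟨a, Finset.mem_union_right _ h1, h2⟩
        rcases hr _ hmem (fun a ha => (Finset.mem_filter.1 ha).2) with ⟨a, h1, h2⟩ | ⟨a, h1, h2⟩
        · exact (Finset.mem_filter.1 h1).2.2 h2
        · exact h2 (hBX h1)
      · have hval : ∀ X' Z, X' ⊆ Z → Z ⊆ (↑Afin : Set A) → (Z, Z) ∈ S →
            (∀ a ∈ Afin.filter (fun a => a ∉ Y), a ∉ Z) →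
            ∃ a ∈ Afin.filter (fun a => a ∈ Y), a ∉ X' := by
          intro X' Z hXZ hZ hZS h
          by_contra hcon
          push Not at hcon
          have : Z = Y := by
            apply Set.Subset.antisymm
            · intro a ha
              by_contra hc
              exact h a (Finset.mem_filter.2 ⟨hZ ha, hc⟩) ha
            · intro a ha
              exact hXZ (hcon a (Finset.mem_filter.2 ⟨hY ha, ha⟩))
          exact hYY (this ▸ hZS)
        have hmem : (⟨∅, Afin.filter (fun a => a ∈ Y),
            Afin.filter (fun a => a ∉ Y)⟩ : Rule A) ∈ canonProg Afin S := by
          rw [mem_canonProg]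
          refine ⟨⟨Finset.empty_subset _, Finset.filter_subset _ _,
            Finset.filter_subset _ _⟩, Or.inl rfl, ?_⟩
          rintro ⟨X', Z⟩ hp
          have hZZ := hc.1 _ _ hp
          refine ⟨?_, fun h => Or.inr (hval X' Z (hS _ hp).1 (hS _ hp).2 hZZ h)⟩
          by_cases h : ∀ a ∈ Afin.filter (fun a => a ∉ Y), a ∉ Z
          · exact Or.inr (hval Z Z subset_rfl (hS _ hp).2 hZZ h)
          · push Not at h
            obtain ⟨a, h1, h2⟩ := h
            exact Or.inl ⟨a, Finset.mem_union_right _ h1, h2⟩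
        rcases hm _ hmem with ⟨a, h1, h2⟩ | ⟨a, h1, h2⟩
        · rcases Finset.mem_union.1 h1 with h1 | h1
          · simp at h1
          · exact (Finset.mem_filter.1 h1).2 h2
        · exact h2 (Finset.mem_filter.1 h1).2
    · intro hp
      refine ⟨(hS _ hp).1, (hS _ hp).2, ?_, ?_⟩
      · intro r hr
        exact (((mem_canonProg _ _ _).1 hr).2.2 _ hp).1
      · rw [isModel_reduct_iff]
        intro r hr
        exact (((mem_canonProg _ _ _).1 hr).2.2 _ hp).2
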